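/- arXiv:2202.03045 — 5 statements merged into one kernel-verified Lean document; each statement's English description precedes it below -/
import Mathlib

section
/- Let ℓ_1, …, ℓ_n be fixed real numbers in [0,L] with mean m := (1/n)·Σ_{i=1}^n ℓ_i. Let I be a uniformly random subset of [n] of a fixed size |I| ≥ 1, sampled without replacement. Then for any δ ∈ (0,1), with probability at least 1−δ: | (1/|I|)·Σ_{i∈I} ℓ_i − m | ≤ m·√(2·ln(2/δ)/|I|) + L·√(2·ln(2/δ)/|I|) + 2L·ln(2/δ)/(3|I|). -/
open scoped Classical


open Finset

lemma aux_A (n k : ℕ) (x : Fin n → ℝ) :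
    ((k:ℝ)+1) * ∑ J ∈ (univ : Finset (Fin n)).powersetCard (k+1), ∏ i ∈ J, x i
      = ∑ I ∈ (univ : Finset (Fin n)).powersetCard k, (∏ i ∈ I, x i) * ∑ j ∈ Iᶜ, x j := by
  have h1 : ((k:ℝ)+1) * ∑ J ∈ (univ : Finset (Fin n)).powersetCard (k+1), ∏ i ∈ J, x i
      = ∑ J ∈ (univ : Finset (Fin n)).powersetCard (k+1), ∑ j ∈ J, ∏ i ∈ J, x i := by
    rw [mul_sum]
    refine sum_congr rfl fun J hJ => ?_
    rw [sum_const, (mem_powersetCard.1 hJ).2]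
    simp
  rw [h1]
  simp_rw [mul_sum]
  rw [sum_sigma', sum_sigma']
  refine sum_bij' (fun p _ => ⟨p.1.erase p.2, p.2⟩) (fun p _ => ⟨insert p.2 p.1, p.2⟩) ?_ ?_ ?_ ?_ ?_
  · rintro ⟨J, j⟩ h
    simp only [mem_sigma, mem_powersetCard, subset_univ, true_and, mem_compl] at h ⊢
    refine ⟨?_, by simp⟩
    rw [card_erase_of_mem h.2, h.1]; rfl
  · rintro ⟨J, j⟩ h
    simp only [mem_sigma, mem_powersetCard, subset_univ, true_and, mem_compl] at h ⊢
    refine ⟨?_, by simp⟩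
    rw [card_insert_of_notMem h.2, h.1]
  · rintro ⟨J, j⟩ h
    simp only [mem_sigma] at h
    simp [insert_erase h.2]
  · rintro ⟨J, j⟩ h
    simp only [mem_sigma, mem_compl] at h
    simp [erase_insert h.2]
  · rintro ⟨J, j⟩ h
    simp only [mem_sigma] at h
    exact (prod_erase_mul J x h.2).symm

lemma aux_B (n k : ℕ) (x : Fin n → ℝ) (hx : ∀ i, 0 ≤ x i) :
    ∑ I ∈ (univ : Finset (Fin n)).powersetCard k,
      ∑ p ∈ I ×ˢ Iᶜ, (∏ i ∈ I, x i) * (x p.2 - x p.1) ≤ 0 := by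
  rw [sum_sigma']
  set S := ((univ : Finset (Fin n)).powersetCard k).sigma (fun I => I ×ˢ Iᶜ) with hS
  let F : (Σ _ : Finset (Fin n), Fin n × Fin n) → ℝ :=
    fun t => (∏ i ∈ t.1, x i) * (x t.2.2 - x t.2.1)
  let φ : (Σ _ : Finset (Fin n), Fin n × Fin n) → (Σ _ : Finset (Fin n), Fin n × Fin n) :=
    fun t => ⟨insert t.2.2 (t.1.erase t.2.1), (t.2.2, t.2.1)⟩
  have hφ : ∀ t ∈ S, φ t ∈ S := by
    rintro ⟨I, i, j⟩ h
    simp only [hS, φ, mem_sigma, mem_powersetCard, subset_univ, true_and, mem_compl, mem_product] at h ⊢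
    obtain ⟨h1, h2, h3⟩ := h
    have hij : i ≠ j := fun h => h3 (h ▸ h2)
    refine ⟨?_, by simp, by simp [hij]⟩
    rw [card_insert_of_notMem (by simp [h3]), card_erase_of_mem h2, h1]
    have := card_pos.2 ⟨i, h2⟩
    omega
  have hφφ : ∀ t ∈ S, φ (φ t) = t := by
    rintro ⟨I, i, j⟩ h
    simp only [hS, φ, mem_sigma, mem_powersetCard, subset_univ, true_and, mem_compl, mem_product] at h ⊢
    obtain ⟨h1, h2, h3⟩ := h
    rw [erase_insert (by simp [h3]), insert_erase h2]
  have e : ∑ t ∈ S, F t = ∑ t ∈ S, F (φ t) :=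
    sum_bij' (fun t _ => φ t) (fun t _ => φ t) hφ hφ hφφ hφφ (fun t ht => by rw [hφφ t ht])
  have h2 : ∑ t ∈ S, F t + ∑ t ∈ S, F (φ t) ≤ 0 := by
    rw [← sum_add_distrib]
    refine sum_nonpos ?_
    rintro ⟨I, i, j⟩ h
    simp only [hS, F, φ, mem_sigma, mem_powersetCard, subset_univ, true_and, mem_compl, mem_product] at h ⊢
    obtain ⟨h1, h2, h3⟩ := h
    rw [prod_insert (by simp [h3]), ← mul_prod_erase I x h2]
    have : 0 ≤ ∏ a ∈ I.erase i, x a := prod_nonneg fun a _ => hx a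
    nlinarith [mul_nonneg this (sq_nonneg (x i - x j))]
  change ∑ t ∈ S, F t ≤ 0
  linarith

lemma aux_C (n k : ℕ) (hk : k ≤ n) (x : Fin n → ℝ) (hx : ∀ i, 0 ≤ x i) :
    (n:ℝ) * ∑ I ∈ (univ : Finset (Fin n)).powersetCard k, (∏ i ∈ I, x i) * ∑ j ∈ Iᶜ, x j
      ≤ ((n:ℝ) - k) * (∑ i, x i) * ∑ I ∈ (univ : Finset (Fin n)).powersetCard k, ∏ i ∈ I, x i := by
  have h := aux_B n k x hx
  rw [← sub_nonpos]
  refine le_of_eq_of_le ?_ h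
  rw [mul_sum, mul_sum, ← sum_sub_distrib]
  refine sum_congr rfl fun I hI => ?_
  have hc := (mem_powersetCard.1 hI).2
  rw [← mul_sum, sum_product]
  simp only [sum_sub_distrib, sum_const, card_compl, hc, Fintype.card_fin, nsmul_eq_mul, ← mul_sum]
  rw [← sum_add_sum_compl I x, Nat.cast_sub hk]
  ring

lemma aux_mac (n : ℕ) (hn : 0 < n) (x : Fin n → ℝ) (hx : ∀ i, 0 ≤ x i) (k : ℕ) (hk : k ≤ n) :
    ∑ I ∈ (univ : Finset (Fin n)).powersetCard k, ∏ i ∈ I, x i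
      ≤ (n.choose k : ℝ) * ((∑ i, x i) / n) ^ k := by
  induction k with
  | zero => simp
  | succ k ih =>
    have ih := ih (by omega)
    have hA := aux_A n k x
    have hC := aux_C n k (by omega) x hx
    rw [← hA] at hC
    have hn' : (0:ℝ) < n := by exact_mod_cast hn
    have hch : (n.choose (k+1) : ℝ) * (k+1) = n.choose k * ((n:ℝ) - k) := by
      have := Nat.choose_succ_right_eq n k
      rw [← Nat.cast_sub (by omega : k ≤ n)]
      exact_mod_cast this
    have hs : 0 ≤ ∑ i, x i := sum_nonneg fun i _ => hx i
    have hnk : (0:ℝ) ≤ (n:ℝ) - k := by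
      rw [sub_nonneg]; exact_mod_cast (by omega : k ≤ n)
    have h3 := mul_le_mul_of_nonneg_left ih (mul_nonneg hnk hs)
    have h4 := hC.trans h3
    have hpos : (0:ℝ) < n * (k+1) := by positivity
    refine le_of_mul_le_mul_left ?_ hpos
    have e : (n:ℝ) * (k+1) * ((n.choose (k+1) : ℝ) * ((∑ i, x i) / n) ^ (k+1))
       = ((n:ℝ) - k) * (∑ i, x i) * ((n.choose k : ℝ) * ((∑ i, x i) / n) ^ k) := by
      calc _ = ((n.choose (k+1) : ℝ) * (k+1)) * (n * ((∑ i, x i) / n)) * ((∑ i, x i) / n) ^ k := by ring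
        _ = _ := by rw [hch, mul_div_cancel₀ _ hn'.ne']; ring
    rw [e]
    linarith

lemma aux_exp (L s y : ℝ) (hL : 0 < L) (hy : |y| ≤ L) :
    Real.exp (s * y) ≤ Real.cosh (s * L) + y * (Real.sinh (s * L) / L) := by
  obtain ⟨h1, h2⟩ := abs_le.1 hy
  have ha : 0 ≤ (L + y) / (2 * L) := div_nonneg (by linarith) (by linarith)
  have hb : 0 ≤ (L - y) / (2 * L) := div_nonneg (by linarith) (by linarith)
  have hab : (L + y) / (2 * L) + (L - y) / (2 * L) = 1 := by field_simp; ring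
  have := (convexOn_exp).2 (Set.mem_univ (s * L)) (Set.mem_univ (-(s * L))) ha hb hab
  simp only [smul_eq_mul] at this
  have e1 : (L + y) / (2 * L) * (s * L) + (L - y) / (2 * L) * -(s * L) = s * y := by
    field_simp; ring
  rw [e1] at this
  refine this.trans_eq ?_
  rw [Real.cosh_eq, Real.sinh_eq]
  field_simp; ring

lemma aux_tail (n : ℕ) (hn : 0 < n) (k : ℕ) (hk : k ≤ n) (L : ℝ) (hL : 0 < L) (y : Fin n → ℝ)
    (hy : ∀ i, |y i| ≤ L) (h0 : ∑ i, y i = 0) (t : ℝ) (ht : 0 ≤ t) :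
    ((((univ : Finset (Fin n)).powersetCard k).filter fun I => k * t < ∑ i ∈ I, y i).card : ℝ)
      ≤ (n.choose k : ℝ) * Real.exp (-(k * t ^ 2 / (2 * L ^ 2))) := by
  set s := t / L ^ 2 with hs
  have hs0 : 0 ≤ s := by positivity
  have hn' : (0:ℝ) < n := by exact_mod_cast hn
  have hmean : (∑ i, Real.exp (s * y i)) / n ≤ Real.exp ((s * L) ^ 2 / 2) := by
    rw [div_le_iff₀ hn']
    calc _ ≤ ∑ i, (Real.cosh (s * L) + y i * (Real.sinh (s * L) / L)) :=
          sum_le_sum fun i _ => aux_exp L s (y i) hL (hy i)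
      _ = Real.cosh (s * L) * n := by
          rw [sum_add_distrib, ← sum_mul, h0]; simp [mul_comm]
      _ ≤ _ := by gcongr; exact Real.cosh_le_exp_half_sq _
  have hm := aux_mac n hn (fun i => Real.exp (s * y i)) (fun i => (Real.exp_pos _).le) k hk
  have hm2 : (n.choose k : ℝ) * ((∑ i, Real.exp (s * y i)) / n) ^ k
      ≤ (n.choose k : ℝ) * Real.exp ((s * L) ^ 2 / 2) ^ k := by
    gcongr
  have hmk : ((((univ : Finset (Fin n)).powersetCard k).filter
      fun I => k * t < ∑ i ∈ I, y i).card : ℝ) * Real.exp (s * (k * t))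
      ≤ ∑ I ∈ (univ : Finset (Fin n)).powersetCard k, ∏ i ∈ I, Real.exp (s * y i) := by
    rw [← nsmul_eq_mul, ← sum_const]
    refine (sum_le_sum fun I hI => ?_).trans
      (sum_le_sum_of_subset_of_nonneg (filter_subset _ _) fun I _ _ =>
        prod_nonneg fun i _ => (Real.exp_pos _).le)
    rw [← Real.exp_sum, ← mul_sum]
    exact Real.exp_le_exp.2 (mul_le_mul_of_nonneg_left (mem_filter.1 hI).2.le hs0)
  have hfin := (hmk.trans hm).trans hm2
  rw [← le_div_iff₀ (Real.exp_pos _)] at hfin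
  refine hfin.trans_eq ?_
  rw [mul_div_assoc, ← Real.exp_nat_mul, ← Real.exp_sub]
  congr 2
  rw [hs]
  field_simp
  ring

/-- Bernstein inequality for sampling without replacement: let
`ℓ₁,…,ℓₙ ∈ [0,L]` be a fixed population with mean `m`, and let `I` be a uniformly random
subset of `[n]` of fixed size `|I| = m₀ ≥ 1`. Then for `δ ∈ (0,1)`, with probability at
least `1 − δ` (i.e. for at least a `(1−δ)`-fraction of the subsets of size `m₀`),
`|(1/|I|)Σ_{i∈I} ℓᵢ − m| ≤ m·√(2 ln(2/δ)/|I|) + L·√(2 ln(2/δ)/|I|) + 2L ln(2/δ)/(3|I|)`. -/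
theorem statement11 (n : ℕ) (L : ℝ) (ℓ : Fin n → ℝ) (hb : ∀ i, ℓ i ∈ Set.Icc 0 L)
    (m₀ : ℕ) (hm₀ : 1 ≤ m₀) (hm₀n : m₀ ≤ n) (δ : ℝ) (hδ : δ ∈ Set.Ioo (0:ℝ) 1) :
    (1 - δ) * (((Finset.univ : Finset (Fin n)).powersetCard m₀).card : ℝ) ≤
      ((((Finset.univ : Finset (Fin n)).powersetCard m₀).filter fun I =>
        |(∑ i ∈ I, ℓ i) / m₀ - (∑ i, ℓ i) / n| ≤
          ((∑ i, ℓ i) / n) * Real.sqrt (2 * Real.log (2 / δ) / m₀) +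
          L * Real.sqrt (2 * Real.log (2 / δ) / m₀) +
          2 * L * Real.log (2 / δ) / (3 * m₀)).card : ℝ) := by
  obtain ⟨hδ0, hδ1⟩ := hδ
  have hn : 0 < n := by omega
  have hn' : (0:ℝ) < n := by exact_mod_cast hn
  have hk' : (0:ℝ) < m₀ := by exact_mod_cast hm₀
  have hL0 : 0 ≤ L := (hb ⟨0, hn⟩).1.trans (hb ⟨0, hn⟩).2
  set m := (∑ i, ℓ i) / n with hm
  have hm0 : 0 ≤ m := div_nonneg (sum_nonneg fun i _ => (hb i).1) hn'.le
  have hmL : m ≤ L := by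
    rw [hm, div_le_iff₀ hn']
    calc _ ≤ ∑ _i : Fin n, L := sum_le_sum fun i _ => (hb i).2
      _ = _ := by simp [mul_comm]
  have hlog : 0 < Real.log (2 / δ) := Real.log_pos (by rw [lt_div_iff₀ hδ0]; linarith)
  set r := Real.sqrt (2 * Real.log (2 / δ) / m₀) with hr
  have hr0 : 0 ≤ r := Real.sqrt_nonneg _
  have hr2 : r ^ 2 = 2 * Real.log (2 / δ) / m₀ := Real.sq_sqrt (by positivity)
  have hB : L * r ≤ m * r + L * r + 2 * L * Real.log (2 / δ) / (3 * m₀) := by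
    have : 0 ≤ m * r := by positivity
    have : 0 ≤ 2 * L * Real.log (2 / δ) / (3 * m₀) := by positivity
    linarith
  set B := m * r + L * r + 2 * L * Real.log (2 / δ) / (3 * m₀) with hBdef
  rcases hL0.eq_or_lt with hL | hL
  · have hz : ∀ i, ℓ i = 0 := fun i => le_antisymm (hL ▸ (hb i).2) (hb i).1
    have hmz : m = 0 := by linarith
    have hB0 : 0 ≤ B := (mul_nonneg hL0 hr0).trans hB
    rw [filter_true_of_mem]
    · nlinarith [Nat.cast_nonneg (α := ℝ) ((univ : Finset (Fin n)).powersetCard m₀).card]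
    · intro I _
      simpa [hz, hmz] using hB0
  set P := (univ : Finset (Fin n)).powersetCard m₀ with hP
  have hPc : (P.card : ℝ) = n.choose m₀ := by simp [hP]
  have hexp : Real.exp (-(m₀ * (L * r) ^ 2 / (2 * L ^ 2))) = δ / 2 := by
    have : (m₀ * (L * r) ^ 2 / (2 * L ^ 2) : ℝ) = Real.log (2 / δ) := by
      rw [mul_pow, hr2]; field_simp
    rw [this, Real.exp_neg, Real.exp_log (by positivity), inv_div]
  have hsum : ∑ i, (ℓ i - m) = 0 := by
    rw [sum_sub_distrib, hm]; simp; field_simp; simp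
  have hab : ∀ i, |ℓ i - m| ≤ L := fun i => by
    have := hb i
    rw [abs_le]; constructor <;> linarith [this.1, this.2]
  have t1 := aux_tail n hn m₀ hm₀n L hL (fun i => ℓ i - m) hab hsum (L * r) (by positivity)
  have t2 := aux_tail n hn m₀ hm₀n L hL (fun i => -(ℓ i - m)) (fun i => by rw [abs_neg]; exact hab i)
    (by rw [sum_neg_distrib, hsum, neg_zero]) (L * r) (by positivity)
  rw [hexp, ← hPc] at t1 t2
  have hsub : P ⊆ (P.filter fun I => |(∑ i ∈ I, ℓ i) / m₀ - m| ≤ B) ∪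
      ((P.filter fun I => m₀ * (L * r) < ∑ i ∈ I, (ℓ i - m)) ∪
       (P.filter fun I => m₀ * (L * r) < ∑ i ∈ I, -(ℓ i - m))) := by
    intro I hI
    simp only [mem_union, mem_filter, hI, true_and]
    by_contra! hcon
    obtain ⟨h1, h2, h3⟩ := hcon
    have hs : ∑ i ∈ I, (ℓ i - m) = m₀ * ((∑ i ∈ I, ℓ i) / m₀ - m) := by
      rw [sum_sub_distrib, sum_const, (mem_powersetCard.1 hI).2, nsmul_eq_mul]
      field_simp
    rw [sum_neg_distrib] at h3
    rw [hs] at h2 h3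
    rw [← mul_neg] at h3
    have h2 := le_of_mul_le_mul_left h2 hk'
    have h3 := le_of_mul_le_mul_left h3 hk'
    have := abs_le'.2 ⟨h2, h3⟩
    linarith
  have hc : (P.card : ℝ) ≤ _ := Nat.cast_le.2 ((card_le_card hsub).trans
    ((card_union_le _ _).trans (Nat.add_le_add_left (card_union_le _ _) _)))
  push_cast at hc
  linarith
end

section
/- Let μ be a Borel probability measure on X×Y with X-marginal μ_X, where (X,ρ) is a metric space and Y is a countable label space with a loss function ℓ : Y×Y → [0,L], L < ∞. Then for every ν > 0 there exists β = β(ν) > 0 with the following property: for every countable measurable partition P = {P_1, P_2, …} of X and every measurable set W ⊆ X satisfying (i) μ_X(X∖W) ≤ ν and (ii) diam(P_i ∩ W) ≤ β for every i, every measurable predictor h : X → Y that is constant on each cell P_i and whose value on P_i is a minimizer over y ∈ Y of ∫_{(P_i ∩ W)×Y} ℓ(y, y') dμ(x,y') (assuming such minimizers exist for each cell) satisfies R(h) ≤ R* + 9Lν. -/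
open MeasureTheory

lemma aux_sep {X Y : Type*} [MetricSpace X] [MeasurableSpace X] [BorelSpace X]
    [Countable Y] [MeasurableSpace Y] [MeasurableSingletonClass Y]
    (m : Measure X) [IsFiniteMeasure m] (f : X → Y) (hf : Measurable f)
    (ε : ENNReal) (hε : ε ≠ 0) :
    ∃ β : ℝ, 0 < β ∧ ∃ F : Set X, MeasurableSet F ∧ m Fᶜ ≤ ε ∧
      ∀ x ∈ F, ∀ x' ∈ F, edist x x' ≤ ENNReal.ofReal β → f x = f x' := by
  obtain ⟨δ, hδ, hsum⟩ := ENNReal.exists_pos_sum_of_countable' hε Y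
  have hfm : ∀ y, MeasurableSet (f ⁻¹' {y}) := fun y => hf (measurableSet_singleton y)
  have hU : ∀ y, ∃ U, U ⊇ f ⁻¹' {y} ∧ IsOpen U ∧ m (U \ f ⁻¹' {y}) < δ y := by
    intro y
    obtain ⟨U, h1, h2, _, h3⟩ := (hfm y).exists_isOpen_diff_lt (measure_ne_top m _) (hδ y).ne'
    exact ⟨U, h1, h2, h3⟩
  choose U hU1 hU2 hU3 using hU
  let F : Set X := (⋃ y, (U y \ f ⁻¹' {y}))ᶜ
  have hFm : MeasurableSet F :=
    (MeasurableSet.iUnion fun y => (hU2 y).measurableSet.diff (hfm y)).compl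
  have hF : m Fᶜ < ε := by
    simp only [F, compl_compl]
    exact ((measure_iUnion_le _).trans (ENNReal.tsum_le_tsum fun y => (hU3 y).le)).trans_lt hsum
  let r : ℕ → ENNReal := fun n => ENNReal.ofReal (1 / ((n : ℝ) + 1))
  have hr : Antitone r := by
    intro a b hab
    apply ENNReal.ofReal_le_ofReal
    have : (a : ℝ) ≤ b := by exact_mod_cast hab
    apply one_div_le_one_div_of_le <;> linarith [(Nat.cast_nonneg a : (0 : ℝ) ≤ a)]
  have hr0 : Filter.Tendsto r Filter.atTop (nhds 0) := by
    have := ENNReal.tendsto_ofReal (tendsto_one_div_add_atTop_nhds_zero_nat (𝕜 := ℝ))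
    simpa [r] using this
  let G : ℕ → Set X := fun n =>
    F ∩ ⋃ y, (f ⁻¹' {y} ∩ {x | r n < Metric.infEDist x (U y)ᶜ})
  have hGm : ∀ n, MeasurableSet (G n) := fun n =>
    hFm.inter (MeasurableSet.iUnion fun y => (hfm y).inter
      (measurableSet_lt measurable_const measurable_infEDist))
  have hGmono : Monotone G := by
    intro a b hab x hx
    refine ⟨hx.1, ?_⟩
    obtain ⟨y, hy, hy'⟩ := Set.mem_iUnion.1 hx.2
    exact Set.mem_iUnion.2 ⟨y, hy, lt_of_le_of_lt (hr hab) hy'⟩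
  have hGU : ⋃ n, G n = F := by
    apply Set.Subset.antisymm (Set.iUnion_subset fun n => Set.inter_subset_left)
    intro x hx
    have h1 : x ∈ U (f x) := hU1 (f x) rfl
    have h2 : 0 < Metric.infEDist x (U (f x))ᶜ := by
      rw [pos_iff_ne_zero]
      intro h0
      have := (Metric.mem_iff_infEDist_zero_of_closed (hU2 (f x)).isClosed_compl).2 h0
      exact this h1
    obtain ⟨n, hn⟩ := (hr0.eventually_lt_const h2).exists
    exact Set.mem_iUnion.2 ⟨n, hx, Set.mem_iUnion.2 ⟨f x, rfl, hn⟩⟩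
  have ht : Filter.Tendsto (fun n => m (G n)ᶜ) Filter.atTop (nhds (m Fᶜ)) := by
    rw [← hGU, Set.compl_iUnion]
    exact tendsto_measure_iInter_atTop (fun n => (hGm n).compl.nullMeasurableSet)
      (fun a b hab => Set.compl_subset_compl.2 (hGmono hab)) ⟨0, measure_ne_top m _⟩
  obtain ⟨n, hn⟩ := (ht.eventually_lt_const hF).exists
  refine ⟨1 / ((n : ℝ) + 1), by positivity, G n, hGm n, hn.le, ?_⟩
  intro x hx x' hx' hd
  obtain ⟨y, hy, hy'⟩ := Set.mem_iUnion.1 hx.2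
  have h1 : x' ∈ U y := by
    by_contra hc
    have h2 : Metric.infEDist x (U y)ᶜ ≤ edist x x' := Metric.infEDist_le_edist_of_mem hc
    exact absurd (h2.trans hd) (not_le.2 hy')
  have h3 : f x' = y := by
    by_contra hc
    exact hx'.1 (Set.mem_iUnion.2 ⟨y, h1, hc⟩)
  rw [h3]; exact hy

/-- (Richness lemma / true medoid predictor.) Let `μ` be a Borel
probability measure on `X × Y` where `(X,ρ)` is a metric space and `Y` a countable label
space with loss `ℓ : Y × Y → [0,L]`. For every `ν > 0` there is `β > 0` such that for every
countable measurable partition `P` of `X` and every measurable `W ⊆ X` with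
`μ_X(X∖W) ≤ ν` and `diam(Pᵢ ∩ W) ≤ β` for all `i`, every measurable predictor `h` that is
constant on each cell and whose value on each cell minimizes the restricted expected loss
`y ↦ ∫_{(Pᵢ∩W)×Y} ℓ(y,y') dμ` satisfies `R(h) ≤ R* + 9Lν`. -/
theorem statement12 {X Y : Type*} [MetricSpace X] [MeasurableSpace X] [BorelSpace X]
    [Countable Y] [Nonempty Y] [MeasurableSpace Y] [MeasurableSingletonClass Y]
    (L : ℝ) (ℓ : Y → Y → ℝ) (hℓ : ∀ y y', ℓ y y' ∈ Set.Icc 0 L)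
    (μ : Measure (X × Y)) [IsProbabilityMeasure μ]
    (ν : ℝ) (hν : 0 < ν) :
    ∃ β : ℝ, 0 < β ∧
      ∀ P : ℕ → Set X,
        (∀ i, MeasurableSet (P i)) →
        Pairwise (Function.onFun Disjoint P) →
        (⋃ i, P i) = Set.univ →
        ∀ W : Set X, MeasurableSet W →
        μ.fst Wᶜ ≤ ENNReal.ofReal ν →
        (∀ i, EMetric.diam (P i ∩ W) ≤ ENNReal.ofReal β) →
        ∀ h : X → Y, Measurable h →
        (∀ i, ∀ x ∈ P i, ∀ x' ∈ P i, h x = h x') →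
        (∀ i, ∀ x ∈ P i, ∀ y : Y,
          (∫ p in (P i ∩ W) ×ˢ (Set.univ : Set Y), ℓ (h x) p.2 ∂μ) ≤
            ∫ p in (P i ∩ W) ×ˢ (Set.univ : Set Y), ℓ y p.2 ∂μ) →
        (∫ p, ℓ (h p.1) p.2 ∂μ) ≤
          (⨅ f : {f : X → Y // Measurable f}, ∫ p, ℓ (f.1 p.1) p.2 ∂μ) + 9 * L * ν := by
  classical
  have hL : 0 ≤ L := by
    obtain ⟨y⟩ := ‹Nonempty Y›
    exact (hℓ y y).1.trans (hℓ y y).2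
  rcases hL.eq_or_lt with hL0 | hLpos
  · have h0 : ∀ y y', ℓ y y' = 0 := fun y y' => le_antisymm (hL0 ▸ (hℓ y y').2) (hℓ y y').1
    exact ⟨1, one_pos, by intros; simp [h0, ← hL0]⟩
  haveI : Nonempty {f : X → Y // Measurable f} :=
    ⟨⟨fun _ => Classical.arbitrary Y, measurable_const⟩⟩
  obtain ⟨⟨f, hf⟩, hfR⟩ := exists_lt_of_ciInf_lt (lt_add_of_pos_right
    (⨅ f : {f : X → Y // Measurable f}, ∫ p, ℓ (f.1 p.1) p.2 ∂μ) (mul_pos hLpos hν))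
  obtain ⟨β, hβ, F, hFm, hFμ, hF⟩ := aux_sep μ.fst f hf (ENNReal.ofReal ν) (by simpa using hν)
  refine ⟨β, hβ, ?_⟩
  intro P hPm hPd hPU W hWm hWμ hdiam h hh hconst hmin
  have hmeas : ∀ g : X → Y, Measurable g → Measurable (fun p : X × Y => ℓ (g p.1) p.2) := by
    intro g hg
    have h1 : Measurable (fun q : Y × Y => ℓ q.1 q.2) := measurable_from_prod_countable_left
      (fun y => measurable_of_countable _)
    exact h1.comp ((hg.comp measurable_fst).prodMk measurable_snd)
  have hint : ∀ g : X → Y, Measurable g → Integrable (fun p : X × Y => ℓ (g p.1) p.2) μ := by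
    intro g hg
    refine Integrable.of_bound (hmeas g hg).aestronglyMeasurable L (Filter.Eventually.of_forall ?_)
    intro p
    rw [Real.norm_of_nonneg (hℓ _ _).1]
    exact (hℓ _ _).2
  have hsmall : ∀ A : Set X, MeasurableSet A → μ.fst A ≤ ENNReal.ofReal ν →
      μ.real (Prod.fst ⁻¹' A) ≤ ν := by
    intro A hA hAν
    rw [Measure.fst_apply hA] at hAν
    exact ENNReal.toReal_le_of_le_ofReal hν.le hAν
  have hmF : MeasurableSet (Prod.fst ⁻¹' Fᶜ : Set (X × Y)) := measurable_fst hFm.compl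
  have hmW : MeasurableSet (Prod.fst ⁻¹' W : Set (X × Y)) := measurable_fst hWm
  let b : X × Y → ℝ := (Prod.fst ⁻¹' Fᶜ : Set (X × Y)).indicator (fun _ => L)
  have hb0 : ∀ p, 0 ≤ b p := fun p => Set.indicator_nonneg (fun _ _ => hL) p
  have hbi : Integrable b μ := (integrable_const L).indicator hmF
  have hbint : ∫ p, b p ∂μ ≤ L * ν := by
    rw [integral_indicator hmF, setIntegral_const, smul_eq_mul, mul_comm]
    exact mul_le_mul_of_nonneg_left (hsmall _ hFm.compl hFμ) hL
  let g : X × Y → ℝ := fun p => ℓ (f p.1) p.2 + b p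
  have hgi : Integrable g μ := (hint f hf).add hbi
  have hg0 : ∀ p, 0 ≤ g p := fun p => add_nonneg (hℓ _ _).1 (hb0 p)
  let S : ℕ → Set (X × Y) := fun i => (P i ∩ W) ×ˢ (Set.univ : Set Y)
  have hSm : ∀ i, MeasurableSet (S i) := fun i => ((hPm i).inter hWm).prod MeasurableSet.univ
  have hSd : Pairwise (Function.onFun Disjoint S) := by
    intro i j hij
    refine Set.disjoint_left.2 fun p hp hq => ?_
    exact Set.disjoint_left.1 (hPd hij) hp.1.1 hq.1.1
  have hSU : ⋃ i, S i = Prod.fst ⁻¹' W := by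
    ext p
    have : p.1 ∈ ⋃ i, P i := hPU ▸ Set.mem_univ _
    obtain ⟨i, hi⟩ := Set.mem_iUnion.1 this
    constructor
    · intro hp
      obtain ⟨j, hj⟩ := Set.mem_iUnion.1 hp
      exact hj.1.2
    · intro hp
      exact Set.mem_iUnion.2 ⟨i, ⟨hi, hp⟩, Set.mem_univ _⟩
  have hcell : ∀ i, ∫ p in S i, ℓ (h p.1) p.2 ∂μ ≤ ∫ p in S i, g p ∂μ := by
    intro i
    by_cases hne : (P i ∩ W ∩ F).Nonempty
    · obtain ⟨x0, ⟨hx0, hx0W⟩, hx0F⟩ := hne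
      have e1 : ∫ p in S i, ℓ (h p.1) p.2 ∂μ = ∫ p in S i, ℓ (h x0) p.2 ∂μ := by
        refine setIntegral_congr_fun (hSm i) fun p hp => ?_
        show ℓ (h p.1) p.2 = ℓ (h x0) p.2
        rw [hconst i p.1 hp.1.1 x0 hx0]
      rw [e1]
      refine (hmin i x0 hx0 (f x0)).trans ?_
      refine setIntegral_mono_on (hint (fun _ => f x0) measurable_const).integrableOn
        hgi.integrableOn (hSm i) fun p hp => ?_
      by_cases hpF : p.1 ∈ F
      · have : f x0 = f p.1 := hF x0 hx0F p.1 hpF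
          ((Metric.edist_le_ediam_of_mem (s := P i ∩ W) ⟨hx0, hx0W⟩ hp.1).trans (hdiam i))
        rw [this]
        exact le_add_of_nonneg_right (hb0 p)
      · have : b p = L := Set.indicator_of_mem (show p ∈ Prod.fst ⁻¹' Fᶜ from hpF) _
        show _ ≤ ℓ (f p.1) p.2 + b p
        linarith [(hℓ (f x0) p.2).2, (hℓ (f p.1) p.2).1]
    · refine setIntegral_mono_on (hint h hh).integrableOn
        hgi.integrableOn (hSm i) fun p hp => ?_
      have hpF : p.1 ∉ F := fun hc => hne ⟨p.1, hp.1, hc⟩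
      have : b p = L := Set.indicator_of_mem (show p ∈ Prod.fst ⁻¹' Fᶜ from hpF) _
      show _ ≤ ℓ (f p.1) p.2 + b p
      linarith [(hℓ (h p.1) p.2).2, (hℓ (f p.1) p.2).1]
  have hW1 : ∫ p in Prod.fst ⁻¹' W, ℓ (h p.1) p.2 ∂μ ≤ ∫ p in Prod.fst ⁻¹' W, g p ∂μ := by
    rw [← hSU]
    exact hasSum_le hcell (hasSum_integral_iUnion hSm hSd (hint h hh).integrableOn)
      (hasSum_integral_iUnion hSm hSd hgi.integrableOn)
  have hW2 : ∫ p in Prod.fst ⁻¹' W, g p ∂μ ≤ ∫ p, g p ∂μ :=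
    setIntegral_le_integral hgi (Filter.Eventually.of_forall hg0)
  have hW3 : ∫ p in (Prod.fst ⁻¹' W)ᶜ, ℓ (h p.1) p.2 ∂μ ≤ L * ν := by
    have h1 : ∫ p in (Prod.fst ⁻¹' W)ᶜ, ℓ (h p.1) p.2 ∂μ ≤
        ∫ p in (Prod.fst ⁻¹' W : Set (X × Y))ᶜ, L ∂μ :=
      setIntegral_mono (hint h hh).integrableOn (integrable_const L).integrableOn
        (fun p => (hℓ _ _).2)
    rw [setIntegral_const, smul_eq_mul, mul_comm] at h1
    exact h1.trans (mul_le_mul_of_nonneg_left (hsmall _ hWm.compl hWμ) hL)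
  have hsplit := integral_add_compl hmW (hint h hh)
  have hgsum : ∫ p, g p ∂μ = ∫ p, ℓ (f p.1) p.2 ∂μ + ∫ p, b p ∂μ :=
    integral_add (hint f hf) hbi
  have hLν := mul_pos hLpos hν
  simp only at hfR
  linarith
end

section
/- Let (X,ρ,μ) be a separable metric probability space and let γ > 0. Then there exists a function N_γ : ℕ → ℝ_+ with N_γ(n) = o(n) such that for all n, P[ sup over all γ-nets G of {X_1,…,X_n} of |G| ≥ N_γ(n) ] ≤ 1/n², where S_n = (X_1,…,X_n) ~ μ^n. -/
open MeasureTheory Filter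

lemma aux_A_s13 {X : Type*} [MeasurableSpace X] (μ : Measure X) [IsProbabilityMeasure μ]
    (U : Set X) (n m : ℕ) :
    (Measure.pi fun _ : Fin n => μ)
      {s : Fin n → X | ∃ T : Finset (Fin n), T.card = m ∧ ∀ i ∈ T, s i ∈ U}
      ≤ 2 ^ n * μ U ^ m := by
  classical
  have h1 : {s : Fin n → X | ∃ T : Finset (Fin n), T.card = m ∧ ∀ i ∈ T, s i ∈ U}
      ⊆ ⋃ T ∈ (Finset.univ : Finset (Fin n)).powersetCard m,
        Set.pi Set.univ (fun i => if i ∈ T then U else Set.univ) := by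
    rintro s ⟨T, hT, hs⟩
    simp only [Set.mem_iUnion]
    refine ⟨T, by simp [hT], ?_⟩
    intro i _
    by_cases h : i ∈ T
    · simpa [h] using hs i h
    · simp [h]
  refine (measure_mono h1).trans ((measure_biUnion_finset_le _ _).trans ?_)
  have h2 : ∀ T ∈ (Finset.univ : Finset (Fin n)).powersetCard m,
      (Measure.pi fun _ : Fin n => μ)
        (Set.pi Set.univ (fun i => if i ∈ T then U else Set.univ)) = μ U ^ m := by
    intro T hT
    have hc : T.card = m := by simpa using hT
    rw [Measure.pi_pi]
    have : ∀ i, μ (if i ∈ T then U else Set.univ) = if i ∈ T then μ U else 1 := by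
      intro i; split_ifs <;> simp
    simp only [this]
    rw [Finset.prod_ite_mem]
    simp [hc]
  rw [Finset.sum_congr rfl h2, Finset.sum_const, nsmul_eq_mul, Finset.card_powersetCard]
  gcongr
  simp only [Finset.card_univ, Fintype.card_fin]
  exact_mod_cast Nat.choose_le_two_pow n m

lemma aux_U {X : Type*} [MetricSpace X] [TopologicalSpace.SeparableSpace X]
    [MeasurableSpace X] [BorelSpace X]
    (μ : Measure X) [IsProbabilityMeasure μ] (γ : ℝ) (hγ : 0 < γ) (ε : ENNReal) (hε : 0 < ε) :
    ∃ (x : ℕ → X) (k : ℕ), μ (⋃ i ∈ Finset.range k, Metric.ball (x i) (γ / 2))ᶜ ≤ ε := by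
  have : Nonempty X := nonempty_of_isProbabilityMeasure μ
  refine ⟨TopologicalSpace.denseSeq X, ?_⟩
  set x := TopologicalSpace.denseSeq X
  have ht := tendsto_measure_iInter_atTop (μ := μ)
    (s := fun k : ℕ => (⋃ i ∈ Finset.range k, Metric.ball (x i) (γ / 2))ᶜ)
    (fun k => ((isOpen_biUnion fun i _ => Metric.isOpen_ball).measurableSet.compl).nullMeasurableSet)
    (by
      intro a b hab
      apply Set.compl_subset_compl.2
      apply Set.biUnion_subset_biUnion_left
      intro i hi
      exact Finset.mem_range.2 (lt_of_lt_of_le (Finset.mem_range.1 hi) hab))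
    ⟨0, measure_ne_top _ _⟩
  have he : (⋂ k : ℕ, (⋃ i ∈ Finset.range k, Metric.ball (x i) (γ / 2))ᶜ) = ∅ := by
    ext y
    simp only [Set.mem_iInter, Set.mem_empty_iff_false, iff_false, not_forall]
    obtain ⟨i, hi⟩ := (TopologicalSpace.denseRange_denseSeq X).exists_dist_lt y (half_pos hγ)
    refine ⟨i + 1, ?_⟩
    simp only [Set.mem_compl_iff, not_not, Set.mem_iUnion]
    exact ⟨i, by simp, hi⟩
  rw [he, measure_empty] at ht
  exact ((ht.eventually (ge_mem_nhds hε)).exists)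

lemma aux_det {X : Type*} [MetricSpace X] (γ : ℝ) (x : ℕ → X) (k n m : ℕ)
    (s : Fin n → X) (G : Finset X) (hG : (↑G : Set X) ⊆ Set.range s)
    (hsep : ∀ x ∈ G, ∀ y ∈ G, x ≠ y → γ ≤ dist x y) (hc : k + m ≤ G.card) :
    ∃ T : Finset (Fin n), T.card = m ∧
      ∀ i ∈ T, s i ∈ (⋃ i ∈ Finset.range k, Metric.ball (x i) (γ / 2))ᶜ := by
  classical
  set V := (⋃ i ∈ Finset.range k, Metric.ball (x i) (γ / 2)) with hV
  have h1 : (G.filter (· ∈ V)).card ≤ k := by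
    have hex : ∀ y ∈ G.filter (· ∈ V), ∃ i ∈ Finset.range k, dist y (x i) < γ / 2 := by
      intro y hy
      have := (Finset.mem_filter.1 hy).2
      simpa [hV] using this
    by_contra! hlt
    have hlt' : (Finset.range k).card < (G.filter (· ∈ V)).card := by simpa using hlt
    choose! f hf using hex
    obtain ⟨a, ha, b, hb, hab, hfab⟩ :=
      Finset.exists_ne_map_eq_of_card_lt_of_maps_to hlt' (f := f) (fun y hy => (hf y hy).1)
    have h3 := hsep a (Finset.mem_filter.1 ha).1 b (Finset.mem_filter.1 hb).1 hab
    have h4 := (hf a ha).2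
    have h5 := (hf b hb).2
    rw [← hfab] at h5
    have := dist_triangle_right a b (x (f a))
    linarith
  have h2 := Finset.card_filter_add_card_filter_not (s := G) (· ∈ V)
  have h3 : (G.filter (¬ · ∈ V)) ⊆ (Finset.univ.filter (fun i => s i ∈ Vᶜ)).image s := by
    intro y hy
    obtain ⟨hy1, hy2⟩ := Finset.mem_filter.1 hy
    obtain ⟨i, rfl⟩ := hG hy1
    exact Finset.mem_image.2 ⟨i, by simpa using hy2, rfl⟩
  have h4 := (Finset.card_le_card h3).trans Finset.card_image_le
  obtain ⟨T, hT, hTm⟩ := Finset.exists_subset_card_eq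
    (s := Finset.univ.filter (fun i => s i ∈ Vᶜ)) (n := m) (by omega)
  exact ⟨T, hTm, fun i hi => (Finset.mem_filter.1 (hT hi)).2⟩

lemma aux_sq (n : ℕ) (hn : 4 ≤ n) : n ^ 2 ≤ 2 ^ n := by
  induction n, hn using Nat.le_induction with
  | base => norm_num
  | succ k hk ih => rw [pow_succ 2 k]; nlinarith

lemma aux_num (r n m : ℕ) (hn : 4 ≤ n) (h : n ≤ r * m) (p : ENNReal)
    (hp : p ≤ (4⁻¹ : ENNReal) ^ r) : 2 ^ n * p ^ m ≤ 1 / (n : ENNReal) ^ 2 := by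
  calc (2:ENNReal) ^ n * p ^ m ≤ 2 ^ n * ((4⁻¹ : ENNReal) ^ r) ^ m := by gcongr
    _ = 2 ^ n * (4⁻¹ : ENNReal) ^ (r * m) := by rw [pow_mul]
    _ ≤ 2 ^ n * (4⁻¹ : ENNReal) ^ n := by
        refine mul_le_mul_right ?_ _
        exact pow_le_pow_right_of_le_one' (ENNReal.inv_le_one.2 (by norm_num)) h
    _ = ((2:ENNReal) ^ n)⁻¹ := by
        rw [← mul_pow, ENNReal.inv_pow]
        congr 1
        rw [show (4:ENNReal) = 2 * 2 by norm_num, ENNReal.mul_inv (by simp) (by simp), ← mul_assoc,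
          ENNReal.mul_inv_cancel (by simp) (by simp), one_mul]
    _ ≤ 1 / (n : ENNReal) ^ 2 := by
        rw [one_div, ENNReal.inv_le_inv]
        exact_mod_cast aux_sq n hn

/-- (Sublinear γ-net size.) Let `(X,ρ,μ)` be a separable metric
probability space and `γ > 0`. There is a function `N_γ : ℕ → ℝ₊` with `N_γ(n) = o(n)`
such that for all `n`, the probability (under `μⁿ`) that some `γ`-net of the sample
`{X₁,…,Xₙ}` has at least `N_γ(n)` points is at most `1/n²`. A `γ`-net of a finite set `A`
is a maximal subset of `A` whose interpoint distances are all at least `γ` (maximality is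
expressed by each point of `A` being within distance `< γ` of the net). -/
theorem statement13 {X : Type*} [MetricSpace X] [TopologicalSpace.SeparableSpace X]
    [MeasurableSpace X] [BorelSpace X]
    (μ : Measure X) [IsProbabilityMeasure μ] (γ : ℝ) (hγ : 0 < γ) :
    ∃ N : ℕ → ℝ, (∀ n, 0 ≤ N n) ∧
      Tendsto (fun n : ℕ => N n / n) atTop (nhds 0) ∧
      ∀ n : ℕ,
        (Measure.pi fun _ : Fin n => μ) {s : Fin n → X |
          ∃ G : Finset X, (↑G : Set X) ⊆ Set.range s ∧
            (∀ x ∈ G, ∀ y ∈ G, x ≠ y → γ ≤ dist x y) ∧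
            (∀ x ∈ Set.range s, ∃ y ∈ G, dist x y < γ) ∧
            N n ≤ G.card} ≤ 1 / (n : ENNReal) ^ 2 := by
  classical
  set E : ℕ → ℕ → ENNReal := fun n t => (Measure.pi fun _ : Fin n => μ) {s : Fin n → X |
          ∃ G : Finset X, (↑G : Set X) ⊆ Set.range s ∧
            (∀ x ∈ G, ∀ y ∈ G, x ≠ y → γ ≤ dist x y) ∧
            (∀ x ∈ Set.range s, ∃ y ∈ G, dist x y < γ) ∧
            ((t : ℕ) : ℝ) ≤ G.card} with hE
  have hex : ∀ n, ∃ t, E n t ≤ 1 / (n : ENNReal) ^ 2 := by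
    intro n
    refine ⟨n + 1, ?_⟩
    have : {s : Fin n → X |
          ∃ G : Finset X, (↑G : Set X) ⊆ Set.range s ∧
            (∀ x ∈ G, ∀ y ∈ G, x ≠ y → γ ≤ dist x y) ∧
            (∀ x ∈ Set.range s, ∃ y ∈ G, dist x y < γ) ∧
            ((n + 1 : ℕ) : ℝ) ≤ G.card} = ∅ := by
      ext s
      simp only [Set.mem_setOf_eq, Set.mem_empty_iff_false, iff_false]
      rintro ⟨G, hG, -, -, hc⟩
      have h1 : G ⊆ Finset.univ.image s := by
        intro y hy
        obtain ⟨i, rfl⟩ := hG hy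
        simp
      have h2 := (Finset.card_le_card h1).trans Finset.card_image_le
      have h3 : n + 1 ≤ G.card := by exact_mod_cast hc
      simp at h2
      omega
    simp only [hE, this, measure_empty, zero_le]
  have hB : ∀ r : ℕ, ∃ k : ℕ, ∀ n, 4 ≤ n → ∀ m, n ≤ r * m →
      E n (k + m) ≤ 1 / (n : ENNReal) ^ 2 := by
    intro r
    obtain ⟨x, k, hk⟩ := aux_U μ γ hγ ((4⁻¹ : ENNReal) ^ r)
      (ENNReal.pow_pos (by simp) r)
    refine ⟨k, fun n hn m hm => ?_⟩
    refine le_trans ?_ ((aux_A_s13 μ _ n m).trans (aux_num r n m hn hm _ hk))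
    apply measure_mono
    rintro s ⟨G, hG, hs, -, hc⟩
    exact aux_det γ x k n m s G hG hs (by exact_mod_cast hc)
  refine ⟨fun n => (Nat.find (hex n) : ℝ), fun n => Nat.cast_nonneg _, ?_,
    fun n => Nat.find_spec (hex n)⟩
  rw [Metric.tendsto_atTop]
  intro ε hε
  obtain ⟨r, hr⟩ := exists_nat_one_div_lt (half_pos hε)
  obtain ⟨k, hk⟩ := hB (r + 1)
  obtain ⟨n1, hn1⟩ := exists_nat_gt (((k : ℝ) + 1) / (ε / 2))
  refine ⟨max 4 n1, fun n hn => ?_⟩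
  have hn4 : 4 ≤ n := (le_max_left _ _).trans hn
  have hnn : (n1 : ℝ) ≤ n := by exact_mod_cast (le_max_right _ _).trans hn
  have hpos : (0 : ℝ) < n := by exact_mod_cast (by omega : 0 < n)
  have hm : n ≤ (r + 1) * (n / (r + 1) + 1) := (Nat.lt_mul_div_succ n (Nat.succ_pos r)).le
  have hf := Nat.find_min' (hex n) (hk n hn4 _ hm)
  have hf' : (Nat.find (hex n) : ℝ) ≤ k + ((n / (r + 1) : ℕ) + 1) := by exact_mod_cast hf
  have hd : ((n / (r + 1) : ℕ) : ℝ) ≤ n / ((r : ℝ) + 1) := by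
    exact_mod_cast (Nat.cast_div_le (m := n) (n := r + 1) (α := ℝ))
  have hq : (n : ℝ) / ((r : ℝ) + 1) < n * (ε / 2) := by
    rw [div_eq_mul_one_div]
    exact mul_lt_mul_of_pos_left hr hpos
  have hk1 : (k : ℝ) + 1 < n * (ε / 2) := by
    rw [div_lt_iff₀ (half_pos hε)] at hn1
    nlinarith
  rw [Real.dist_eq, sub_zero, abs_of_nonneg (by positivity), div_lt_iff₀ hpos]
  linarith
end

section
/- Let (X,ρ,μ) be a separable metric probability space and let γ > 0 be fixed. Define the γ-missing mass of a sample S_n = (X_1,…,X_n) as M_γ(S_n) := μ( X ∖ ∪_{i=1}^n B_γ(X_i) ), where B_γ(x) is the open ball of radius γ about x. Then there exists a function u_γ : ℕ → ℝ_+ with u_γ(n) = o(1) such that for all n ∈ ℕ and all t > 0, P[ M_γ(S_n) ≥ u_γ(n) + t ] ≤ exp(−n t²) for S_n ~ μ^n. -/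
open MeasureTheory Filter

/-- (Missing mass.) Let `(X,ρ,μ)` be a separable metric probability
space and `γ > 0`. Define the `γ`-missing mass of a sample `(X₁,…,Xₙ)` as
`M_γ = μ(X ∖ ⋃ᵢ B_γ(Xᵢ))`. There is `u_γ : ℕ → ℝ₊` with `u_γ(n) = o(1)` such that for
all `n` and `t > 0`, `P[M_γ(Sₙ) ≥ u_γ(n) + t] ≤ exp(−n t²)` for `Sₙ ~ μⁿ`. -/
theorem statement14 {X : Type*} [MetricSpace X] [TopologicalSpace.SeparableSpace X]
    [MeasurableSpace X] [BorelSpace X]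
    (μ : Measure X) [IsProbabilityMeasure μ] (γ : ℝ) (hγ : 0 < γ) :
    ∃ u : ℕ → ℝ, (∀ n, 0 ≤ u n) ∧
      Tendsto u atTop (nhds 0) ∧
      ∀ (n : ℕ) (t : ℝ), 0 < t →
        (Measure.pi fun _ : Fin n => μ) {s : Fin n → X |
          ENNReal.ofReal (u n + t) ≤ μ (⋃ i, Metric.ball (s i) γ)ᶜ} ≤
        ENNReal.ofReal (Real.exp (-(n * t ^ 2))) := by
  classical
  haveI : Nonempty X := nonempty_of_isProbabilityMeasure μ
  set A : ℕ → Set X := fun j => Metric.ball (TopologicalSpace.denseSeq X j) (γ / 2) with hA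
  have hAm : ∀ j, MeasurableSet (A j) := fun j => Metric.isOpen_ball.measurableSet
  have hAd : ∀ j x y, x ∈ A j → y ∈ A j → dist x y < γ := by
    intro j x y hx hy
    have h1 := Metric.mem_ball.1 hx
    have h2 := Metric.mem_ball'.1 hy
    have := dist_triangle x (TopologicalSpace.denseSeq X j) y
    linarith
  have hAu : ∀ x, ∃ j, x ∈ A j := by
    intro x
    obtain ⟨j, hj⟩ := (TopologicalSpace.denseRange_denseSeq X).exists_dist_lt x (half_pos hγ)
    exact ⟨j, Metric.mem_ball.2 hj⟩
  set B : Finset ℕ → Set X := fun S => ⋃ j ∈ S, A j with hB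
  have hBm : ∀ S, MeasurableSet (B S) := fun S => S.measurableSet_biUnion (fun j _ => hAm j)
  set d : ℕ → ℝ := fun J => μ.real (B (Finset.range J))ᶜ with hd
  have hdlim : Tendsto d atTop (nhds 0) := by
    have h1 : Tendsto (fun J => μ (B (Finset.range J))ᶜ) atTop
        (nhds (μ (⋂ J, (B (Finset.range J))ᶜ))) := by
      apply tendsto_measure_iInter_atTop
      · exact fun J => (hBm _).compl.nullMeasurableSet
      · intro a b hab
        apply Set.compl_subset_compl.2
        exact Set.biUnion_subset_biUnion_left (fun j hj => by
          have := Finset.mem_range.1 hj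
          exact Finset.mem_range.2 (by omega))
      · exact ⟨0, measure_ne_top _ _⟩
    have h2 : (⋂ J, (B (Finset.range J))ᶜ) = ∅ := by
      apply Set.eq_empty_of_forall_notMem
      intro x hx
      obtain ⟨j, hj⟩ := hAu x
      have := Set.mem_iInter.1 hx (j + 1)
      exact this (Set.mem_biUnion (Finset.mem_range.2 (Nat.lt_succ_self j)) hj)
    rw [h2, measure_empty] at h1
    have := (ENNReal.tendsto_toReal ENNReal.zero_ne_top).comp h1
    simpa [hd, Measure.real, Function.comp_def] using this
  have hsq : Tendsto Nat.sqrt atTop atTop := by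
    apply tendsto_atTop.2
    intro b
    filter_upwards [eventually_ge_atTop (b * b)] with n hn
    exact Nat.le_sqrt.2 hn
  refine ⟨fun n => d (Nat.sqrt n) + (Nat.sqrt n : ℝ) / n, ?_, ?_, ?_⟩
  · intro n
    have : 0 ≤ d (Nat.sqrt n) := measureReal_nonneg
    positivity
  · have h1 : Tendsto (fun n : ℕ => (Nat.sqrt n : ℝ) / n) atTop (nhds 0) := by
      have h3 : Tendsto (fun n : ℕ => 1 / (Nat.sqrt n : ℝ)) atTop (nhds 0) :=
        (tendsto_one_div_atTop_nhds_zero_nat (𝕜 := ℝ)).comp hsq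
      refine squeeze_zero' (Eventually.of_forall fun n => by positivity) ?_ h3
      filter_upwards [eventually_ge_atTop 1] with n hn
      have hJ : 0 < Nat.sqrt n := Nat.sqrt_pos.2 hn
      have hle : ((Nat.sqrt n * Nat.sqrt n : ℕ) : ℝ) ≤ n := by exact_mod_cast Nat.sqrt_le n
      push_cast at hle
      have hJ' : (0 : ℝ) < Nat.sqrt n := by exact_mod_cast hJ
      have hn' : (0 : ℝ) < n := by exact_mod_cast hn
      rw [div_le_div_iff₀ hn' hJ']
      linarith
    simpa using (hdlim.comp hsq).add h1
  · intro n t ht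
    rcases Nat.eq_zero_or_pos n with rfl | hn
    · simpa using prob_le_one
    have hn' : (0 : ℝ) < n := by exact_mod_cast hn
    set J := Nat.sqrt n with hJ
    set a : ℝ := (J : ℝ) / n with ha
    have ha0 : 0 ≤ a := by positivity
    have hd0 : 0 ≤ d J := measureReal_nonneg
    have hna : (n : ℝ) * a = J := by rw [ha]; field_simp
    set F := (Finset.range J).powerset.filter (fun S => a + t ≤ μ.real (B S)) with hF
    have hsub : {s : Fin n → X |
          ENNReal.ofReal (d J + a + t) ≤ μ (⋃ i, Metric.ball (s i) γ)ᶜ} ⊆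
        ⋃ S ∈ F, Set.pi Set.univ (fun _ : Fin n => (B S)ᶜ) := by
      intro s hs
      rw [Set.mem_setOf_eq] at hs
      set S := (Finset.range J).filter (fun j => ∀ i, s i ∉ A j) with hS
      have hcov : (⋃ i, Metric.ball (s i) γ)ᶜ ⊆ B S ∪ (B (Finset.range J))ᶜ := by
        intro x hx
        by_cases hxV : x ∈ B (Finset.range J)
        · left
          obtain ⟨j, hj, hxj⟩ := Set.mem_iUnion₂.1 hxV
          refine Set.mem_biUnion (Finset.mem_filter.2 ⟨hj, ?_⟩) hxj
          intro i hi
          exact hx (Set.mem_iUnion.2 ⟨i, Metric.mem_ball.2 (hAd j x (s i) hxj hi)⟩)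
        · right; exact hxV
      have hle : d J + a + t ≤ μ.real (⋃ i, Metric.ball (s i) γ)ᶜ :=
        (ENNReal.ofReal_le_iff_le_toReal (measure_ne_top _ _)).1 hs
      have hle2 : μ.real (⋃ i, Metric.ball (s i) γ)ᶜ ≤ μ.real (B S) + d J :=
        (measureReal_mono hcov).trans (measureReal_union_le _ _)
      refine Set.mem_biUnion (x := S) (Finset.mem_filter.2
        ⟨Finset.mem_powerset.2 (Finset.filter_subset _ _), by linarith⟩) ?_
      intro i _ hi
      obtain ⟨j, hj, hij⟩ := Set.mem_iUnion₂.1 hi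
      exact (Finset.mem_filter.1 hj).2 i hij
    have hone : ∀ S ∈ F, (Measure.pi fun _ : Fin n => μ)
        (Set.pi Set.univ (fun _ : Fin n => (B S)ᶜ)) ≤
        ENNReal.ofReal (Real.exp (-(n * (a + t)))) := by
      intro S hS
      have hS2 := (Finset.mem_filter.1 hS).2
      have h1 : μ.real (B S)ᶜ ≤ Real.exp (-(a + t)) := by
        rw [probReal_compl_eq_one_sub (hBm S)]
        have := Real.add_one_le_exp (-(a + t))
        linarith
      rw [Measure.pi_pi, Finset.prod_const, Finset.card_univ, Fintype.card_fin,
        ← ofReal_measureReal (μ := μ) (s := (B S)ᶜ), ← ENNReal.ofReal_pow measureReal_nonneg]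
      apply ENNReal.ofReal_le_ofReal
      calc _ ≤ Real.exp (-(a + t)) ^ n := pow_le_pow_left₀ measureReal_nonneg h1 n
        _ = _ := by rw [← Real.exp_nat_mul]; ring_nf
    have hcard : F.card ≤ 2 ^ J := by
      refine (Finset.card_filter_le _ _).trans ?_
      simp
    by_cases ht1 : t ≤ 1
    · refine (measure_mono hsub).trans ((measure_biUnion_finset_le _ _).trans
        ((Finset.sum_le_sum hone).trans ?_))
      rw [Finset.sum_const, nsmul_eq_mul, ← ENNReal.ofReal_natCast,
        ← ENNReal.ofReal_mul (Nat.cast_nonneg _)]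
      apply ENNReal.ofReal_le_ofReal
      have h2 : (F.card : ℝ) ≤ Real.exp J := by
        have h3 : (F.card : ℝ) ≤ 2 ^ J := by exact_mod_cast hcard
        have h4 : (2 : ℝ) ≤ Real.exp 1 := by
          have := Real.add_one_le_exp (1 : ℝ)
          linarith
        calc _ ≤ (2 : ℝ) ^ J := h3
          _ ≤ Real.exp 1 ^ J := pow_le_pow_left₀ (by norm_num) h4 J
          _ = _ := by rw [← Real.exp_nat_mul, mul_one]
      calc _ ≤ Real.exp J * Real.exp (-(n * (a + t))) :=
            mul_le_mul_of_nonneg_right h2 (Real.exp_pos _).le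
        _ = Real.exp (-(n * t)) := by
            rw [← Real.exp_add, mul_add, hna]; ring_nf
        _ ≤ _ := by
            apply Real.exp_le_exp.2
            have : t ^ 2 ≤ t := by nlinarith
            have := mul_le_mul_of_nonneg_left this hn'.le
            linarith
    · have hFe : F = ∅ := by
        apply Finset.filter_eq_empty_iff.2
        intro S _ h
        have := measureReal_le_one (μ := μ) (s := B S)
        linarith
      rw [hFe] at hsub
      refine (measure_mono hsub).trans ?_
      simp
end

section
/- Let (X,ρ) and (Y,ℓ) be metric spaces and μ a Borel probability measure on X×Y with E_{(X,Y)~μ} ℓ(y_0,Y) < ∞ for a fixed y_0 ∈ Y. Let f* : X → Y be a measurable Bayes-optimal predictor, i.e., R(f*) = R* and for μ_X-almost every x, f*(x) minimizes y ↦ E[ℓ(y,Y) | X = x] over Y. Let L_n ↑ ∞ and let f*_n : X → Y be measurable predictors such that for every x: (i) f*_n(x) lies in the closed ball B(y_0,L_n), (ii) E[ℓ(f*_n(x),Y) | X = x] ≤ E[ℓ(y_0,Y) | X = x], and (iii) f*_n(x) = f*(x) whenever ℓ(y_0, f*(x)) ≤ L_n. Then lim_{n→∞} R(f*_n) = R(f*)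 = R*. -/
open MeasureTheory ProbabilityTheory Filter
open scoped ProbabilityTheory

/-- (Risk of the diameter-truncated Bayes predictor.) Let `μ` be a Borel
probability measure on `X × Y` (metric spaces) that is bounded in expectation at `y₀`, and
disintegrate `μ = μ_X ⊗ κ` with `κ` the conditional law of `Y` given `X`. Let `f*` be a
measurable Bayes-optimal predictor (globally and pointwise a.e.), `Lₙ ↑ ∞`, and let
`f*ₙ` be measurable predictors with values in the closed ball `B(y₀,Lₙ)`, with conditional
risk at each `x` at most that of `y₀`, and with `f*ₙ(x) = f*(x)` whenever
`ℓ(y₀,f*(x)) ≤ Lₙ`. Then `lim R(f*ₙ) = R(f*) = R*`. -/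
theorem statement17 {X Y : Type*} [MetricSpace X] [MetricSpace Y]
    [MeasurableSpace X] [BorelSpace X] [MeasurableSpace Y] [BorelSpace Y]
    (μ : Measure (X × Y)) [IsProbabilityMeasure μ]
    (κ : Kernel X Y) [IsMarkovKernel κ]
    (hdis : μ = μ.fst ⊗ₘ κ)
    (y0 : Y) (hy0 : ∫⁻ p, ENNReal.ofReal (dist y0 p.2) ∂μ ≠ ⊤)
    (fstar : X → Y) (hfmeas : Measurable fstar)
    (hfopt : (∫⁻ p, ENNReal.ofReal (dist (fstar p.1) p.2) ∂μ) =
      ⨅ (f : X → Y) (_ : Measurable f), ∫⁻ p, ENNReal.ofReal (dist (f p.1) p.2) ∂μ)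
    (hfptwise : ∀ᵐ x ∂μ.fst, ∀ y : Y,
      (∫⁻ y', ENNReal.ofReal (dist (fstar x) y') ∂(κ x)) ≤
        ∫⁻ y', ENNReal.ofReal (dist y y') ∂(κ x))
    (Lseq : ℕ → ℝ) (hLmono : Monotone Lseq) (hLtop : Tendsto Lseq atTop atTop)
    (fn : ℕ → X → Y) (hfnmeas : ∀ n, Measurable (fn n))
    (hball : ∀ n x, dist y0 (fn n x) ≤ Lseq n)
    (hdom : ∀ n x, (∫⁻ y', ENNReal.ofReal (dist (fn n x) y') ∂(κ x)) ≤
      ∫⁻ y', ENNReal.ofReal (dist y0 y') ∂(κ x))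
    (htrunc : ∀ n x, dist y0 (fstar x) ≤ Lseq n → fn n x = fstar x) :
    Tendsto (fun n => ∫⁻ p, ENNReal.ofReal (dist (fn n p.1) p.2) ∂μ) atTop
      (nhds (⨅ (f : X → Y) (_ : Measurable f),
        ∫⁻ p, ENNReal.ofReal (dist (f p.1) p.2) ∂μ)) := by
  have hgm : Measurable (fun y : Y => ENNReal.ofReal (dist y0 y)) :=
    (continuous_const.dist continuous_id).measurable.ennreal_ofReal
  have hdm : Measurable (fun x : X => dist y0 (fstar x)) :=
    (continuous_const.dist continuous_id).measurable.comp hfmeas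
  set A : ℕ → Set X := fun n => {x | Lseq n < dist y0 (fstar x)} with hA
  have hAm : ∀ n, MeasurableSet (A n) := fun n => measurableSet_lt measurable_const hdm
  have hSm : ∀ n, MeasurableSet (A n ×ˢ (Set.univ : Set Y)) := fun n =>
    (hAm n).prod MeasurableSet.univ
  have key : ∀ n, ∀ h : X × Y → ENNReal, Measurable h →
      ∫⁻ p in A n ×ˢ (Set.univ : Set Y), h p ∂μ = ∫⁻ x in A n, ∫⁻ y, h (x, y) ∂(κ x) ∂μ.fst := by
    intro n h hh
    conv_lhs => rw [hdis]
    rw [Measure.setLIntegral_compProd hh (hAm n) MeasurableSet.univ]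
    simp
  have hA0 : Tendsto (fun n => μ (A n ×ˢ (Set.univ : Set Y))) atTop (nhds 0) := by
    have h1 := tendsto_measure_iInter_atTop (μ := μ)
      (s := fun n => A n ×ˢ (Set.univ : Set Y)) (fun n => (hSm n).nullMeasurableSet)
      (fun m n hmn => Set.prod_mono
        (fun x (hx : Lseq n < dist y0 (fstar x)) => lt_of_le_of_lt (hLmono hmn) hx) le_rfl)
      ⟨0, measure_ne_top _ _⟩
    have h2 : (⋂ n, A n ×ˢ (Set.univ : Set Y)) = ∅ := by
      ext p
      simp only [Set.mem_iInter, Set.mem_prod, Set.mem_univ, and_true, Set.mem_empty_iff_false,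
        iff_false, not_forall]
      obtain ⟨n, hn⟩ := (hLtop.eventually_ge_atTop (dist y0 (fstar p.1))).exists
      exact ⟨n, not_lt.mpr hn⟩
    rwa [h2, measure_empty] at h1
  have hlim := tendsto_setLIntegral_zero hy0 hA0
  have hup : ∀ n, ∫⁻ p, ENNReal.ofReal (dist (fn n p.1) p.2) ∂μ ≤
      (∫⁻ p in A n ×ˢ (Set.univ : Set Y), ENNReal.ofReal (dist y0 p.2) ∂μ) +
        ∫⁻ p, ENNReal.ofReal (dist (fstar p.1) p.2) ∂μ := by
    intro n
    rw [← lintegral_add_compl _ (hSm n)]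
    refine add_le_add ?_ ?_
    · obtain ⟨h, hm, hle, heq⟩ := exists_measurable_le_lintegral_eq
        (μ.restrict (A n ×ˢ (Set.univ : Set Y)))
        (fun p => ENNReal.ofReal (dist (fn n p.1) p.2))
      rw [heq, key n h hm, key n (fun p => ENNReal.ofReal (dist y0 p.2)) (hgm.comp measurable_snd)]
      refine lintegral_mono fun x => ?_
      exact (lintegral_mono fun y => hle (x, y)).trans (hdom n x)
    · refine le_trans (le_of_eq ?_) (setLIntegral_le_lintegral (A n ×ˢ (Set.univ : Set Y))ᶜ _)
      refine setLIntegral_congr_fun (hSm n).compl fun p hp => ?_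
      have hp' : dist y0 (fstar p.1) ≤ Lseq n := by
        by_contra hc
        exact hp ⟨not_le.mp hc, trivial⟩
      simp only [htrunc n p.1 hp']
  rw [← hfopt]
  refine tendsto_of_tendsto_of_tendsto_of_le_of_le tendsto_const_nhds
    (by simpa using hlim.add_const (∫⁻ p, ENNReal.ofReal (dist (fstar p.1) p.2) ∂μ))
    (fun n => ?_) hup
  simp only [hfopt]
  exact iInf₂_le (fn n) (hfnmeas n)
end
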